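/- For all r_L > 0, r_R > 0, δ ∈ ℝ, and every configuration c ∈ ℝ³, applying L_{r_L}(δ), then R_{r_R}(π), then L_{r_L}(δ) to c yields exactly the same configuration as applying R_{r_R}(π/2 − δ), then S(2(r_L + r_R)(1 − cos δ)), then R_{r_R}(π/2 − δ) to c. -/

import Mathlib

open Real

/-- A configuration of a planar Dubins vehicle: position `(x, y)` and heading `α`. -/
abbrev Config := ℝ × ℝ × ℝ

/-- Action of a left-turn arc of radius `r` and angle `φ` on a configuration. -/
noncomputable def leftTurn (r φ : ℝ) (c : Config) : Config :=
  (c.1 + r * (Real.sin (c.2.2 + φ) - Real.sin c.2.2),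
   c.2.1 + r * (Real.cos c.2.2 - Real.cos (c.2.2 + φ)),
   c.2.2 + φ)

/-- Action of a right-turn arc of radius `r` and angle `φ` on a configuration. -/
noncomputable def rightTurn (r φ : ℝ) (c : Config) : Config :=
  (c.1 + r * (Real.sin c.2.2 - Real.sin (c.2.2 - φ)),
   c.2.1 + r * (Real.cos (c.2.2 - φ) - Real.cos c.2.2),
   c.2.2 - φ)

/-- Action of a straight segment of length `l` on a configuration. -/
noncomputable def straight (l : ℝ) (c : Config) : Config :=
  (c.1 + l * Real.cos c.2.2, c.2.1 + l * Real.sin c.2.2, c.2.2)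

/-- Applying `L_{r_L}(δ)`, then `R_{r_R}(π)`, then `L_{r_L}(δ)` yields the same
configuration as applying `R_{r_R}(π/2 − δ)`, then `S(2(r_L + r_R)(1 − cos δ))`,
then `R_{r_R}(π/2 − δ)`. -/
theorem LRL_eq_RSR (rL rR : ℝ) (hrL : 0 < rL) (hrR : 0 < rR) (δ : ℝ) (c : Config) :
    leftTurn rL δ (rightTurn rR π (leftTurn rL δ c)) =
      rightTurn rR (π / 2 - δ)
        (straight (2 * (rL + rR) * (1 - Real.cos δ))
          (rightTurn rR (π / 2 - δ) c)) := by
  obtain ⟨x, y, α⟩ := c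
  obtain ⟨β, rfl⟩ : ∃ β, α = β - δ := ⟨α + δ, by ring⟩
  have h_mid : β - δ - (π / 2 - δ) = β - π / 2 := by ring
  have h_turn : β - π + δ = β + δ - π := by ring
  have h_end : β - π / 2 - (π / 2 - δ) = β + δ - π := by ring
  simp only [leftTurn, rightTurn, straight, sub_add_cancel, h_mid, h_turn, h_end,
    Real.sin_sub_pi, Real.cos_sub_pi, Real.sin_sub_pi_div_two, Real.cos_sub_pi_div_two,
    Real.sin_add, Real.cos_add, Real.sin_sub β δ, Real.cos_sub β δ, Prod.mk.injEq]
  refine ⟨?_, ?_, trivial⟩ <;> ring
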